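/- Let k ≥ 3 and p₁ < p₂ be natural numbers with p₂ − p₁ not divisible by k, and let P = kℕ ∪ {p₁, p₂} (where kℕ = {k, 2k, 3k, …}). Then the spacing shift (Σ_P, σ_P) is not topologically transitive, although P is an IP−IP set. -/

import Mathlib

open Filter Topology

/-- The spacing shift `Σ_P ⊆ {0,1}^ℕ` determined by `P ⊆ ℕ`: a `0`-`1` sequence `x`
(encoded as `x : ℕ → Bool`) belongs to `Σ_P` iff whenever two coordinates are `1`,
the (positive) distance between them lies in `P`. -/
def SpacingShift (P : Set ℕ) : Set (ℕ → Bool) :=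
  {x | ∀ i j : ℕ, i < j → x i = true → x j = true → j - i ∈ P}

/-- The left shift map `σ` on sequences. -/
def shift (x : ℕ → Bool) : ℕ → Bool := fun n => x (n + 1)

/-- The support `A_y = {i : y_i = 1}` of a point of the shift space. -/
def supp (x : ℕ → Bool) : Set ℕ := {i | x i = true}

/-- `A ⊆ ℕ` has density `d`, i.e. `|A ∩ {1,…,n}| / n → d`. -/
def HasDensity (A : Set ℕ) (d : ℝ) : Prop :=
  Tendsto (fun n : ℕ => (Nat.card (A ∩ Set.Icc 1 n : Set ℕ) : ℝ) / n) atTop (𝓝 d)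

/-- The upper density `d̄(A) = limsup_n |A ∩ {1,…,n}| / n`. -/
noncomputable def upperDensity (A : Set ℕ) : ℝ :=
  limsup (fun n : ℕ => (Nat.card (A ∩ Set.Icc 1 n : Set ℕ) : ℝ) / n) atTop

/-- The upper Banach density `d*(A)`: the limsup, as the window length tends to infinity,
of the maximal proportion of elements of `A` in a window of that length. -/
noncomputable def upperBanachDensity (A : Set ℕ) : ℝ :=
  limsup (fun n : ℕ =>
    ⨆ m : ℕ, (Nat.card (A ∩ Set.Icc m (m + n) : Set ℕ) : ℝ) / (n + 1)) atTop

/-- `D ⊆ ℕ` is a Δ-set: it contains the difference set `{s_i - s_j : i > j}` of some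
strictly increasing sequence of natural numbers. -/
def IsDeltaSet (D : Set ℕ) : Prop :=
  ∃ s : ℕ → ℕ, StrictMono s ∧ ∀ i j : ℕ, j < i → s i - s j ∈ D

/-- `D ⊆ ℕ` is a Δ*-set: it meets every Δ-set. -/
def IsDeltaStarSet (D : Set ℕ) : Prop :=
  ∀ D' : Set ℕ, IsDeltaSet D' → (D ∩ D').Nonempty

open Classical in
/-- The standard metric on the shift space: `d(x,y) = 2^{-min{n : x_n ≠ y_n}}`,
and `d(x,x) = 0`. -/
noncomputable def seqDist (x y : ℕ → Bool) : ℝ :=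
  if x = y then 0 else (2 : ℝ)⁻¹ ^ sInf {n : ℕ | x n ≠ y n}

/-- The set `FS((a_n))` of finite sums of a sequence of natural numbers:
all sums `a_{i_1} + ⋯ + a_{i_k}` with `i_1 < ⋯ < i_k`. -/
def FSseq (a : ℕ → ℕ) : Set ℕ :=
  {n | ∃ F : Finset ℕ, F.Nonempty ∧ n = ∑ i ∈ F, a i}

/-- `S ⊆ ℕ` is an IP-set: it contains the finite sums of some sequence of positive
natural numbers. -/
def IsIPSet (S : Set ℕ) : Prop :=
  ∃ a : ℕ → ℕ, (∀ n, 0 < a n) ∧ FSseq a ⊆ S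

/-- The set `FS(A)` of finite sums of distinct elements of a set `A ⊆ ℕ`. -/
def FSset (A : Set ℕ) : Set ℕ :=
  {n | ∃ F : Finset ℕ, ↑F ⊆ A ∧ F.Nonempty ∧ n = ∑ i ∈ F, i}

/-- The spacing shift `(Σ_P, σ_P)` is topologically transitive: some point of `Σ_P`
has forward orbit (under the shift) dense in `Σ_P`. -/
def IsTransitiveShift (P : Set ℕ) : Prop :=
  ∃ x ∈ SpacingShift P, SpacingShift P ⊆ closure {y : ℕ → Bool | ∃ n : ℕ, shift^[n] x = y}

/-- `E ⊆ ℕ` is density intersective: it meets the difference set `A - A` of every set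
`A ⊆ ℕ` of positive upper Banach density. -/
def DensityIntersective (E : Set ℕ) : Prop :=
  ∀ A : Set ℕ, 0 < upperBanachDensity A → ∃ a ∈ A, ∃ a' ∈ A, a' < a ∧ a - a' ∈ E

theorem shift_iterate_apply (n : ℕ) (x : ℕ → Bool) (i : ℕ) : shift^[n] x i = x (i + n) := by
  induction n generalizing x with
  | zero => rfl
  | succ n ih => rw [Function.iterate_succ_apply, ih]; rfl

/-- A point in the orbit closure of `x` agrees with some iterate of `x` on any finite set. -/
theorem exists_agree_of_mem_orbit_closure {x y : ℕ → Bool}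
    (hy : y ∈ closure {z : ℕ → Bool | ∃ n : ℕ, shift^[n] x = z}) (F : Finset ℕ) :
    ∃ n, ∀ i ∈ F, x (i + n) = y i := by
  have hopen : IsOpen (Set.pi (F : Set ℕ) fun i => ({y i} : Set Bool)) :=
    isOpen_set_pi F.finite_toSet fun _ _ => isOpen_discrete _
  obtain ⟨z, hz, n, rfl⟩ := mem_closure_iff.1 hy _ hopen fun i _ => rfl
  exact ⟨n, fun i hi => (shift_iterate_apply n x i).symm.trans (hz i hi)⟩

/-- If `Σ_P` is transitive, then every `p ∈ P` is the difference of two arbitrarily large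
elements of `P`. -/
theorem IsTransitiveShift.exists_gt_add_mem {P : Set ℕ} (h : IsTransitiveShift P) {p : ℕ}
    (hp : p ∈ P) (N : ℕ) : ∃ q, N < q ∧ q ∈ P ∧ q + p ∈ P := by
  obtain ⟨x, hx, hdense⟩ := h
  have hpair : (fun i => decide (i = 0 ∨ i = p)) ∈ SpacingShift P := by
    intro i j hij hi hj
    simp only [decide_eq_true_eq] at hi hj
    obtain rfl : i = 0 := by omega
    obtain rfl : j = p := by omega
    simpa using hp
  obtain ⟨n, hn⟩ := exists_agree_of_mem_orbit_closure (hdense hpair) {0, p}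
  have hx₀ : x n = true := by simpa using hn 0 (by simp)
  have hx₁ : x (p + n) = true := by simpa using hn p (by simp)
  have hsingle : (fun i => decide (i = p + n + N + 1)) ∈ SpacingShift P := by
    intro i j hij hi hj
    simp only [decide_eq_true_eq] at hi hj
    omega
  obtain ⟨m, hm⟩ := exists_agree_of_mem_orbit_closure (hdense hsingle) {p + n + N + 1}
  have hx₂ : x (p + n + N + 1 + m) = true := by simpa using hm (p + n + N + 1) (by simp)
  refine ⟨N + 1 + m, by omega, ?_, ?_⟩
  · convert hx _ _ (by omega) hx₁ hx₂ using 1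
    omega
  · convert hx _ _ (by omega) hx₀ hx₂ using 1
    omega

/-- For `k ≥ 3` and `p₁ < p₂` with `k ∤ (p₂ - p₁)`, the spacing shift of
`P = kℕ ∪ {p₁, p₂}` is not topologically transitive, although `P` is an IP−IP set. -/
theorem kN_union_pair_not_transitive_but_IP_sub_IP (k p₁ p₂ : ℕ) (hk : 3 ≤ k)
    (hp₁ : 0 < p₁) (hlt : p₁ < p₂) (hnd : ¬ k ∣ (p₂ - p₁)) :
    ¬ IsTransitiveShift ({n : ℕ | ∃ m : ℕ, 0 < m ∧ n = k * m} ∪ {p₁, p₂}) ∧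
      ∃ S : Set ℕ, IsIPSet S ∧ ∀ s ∈ S, ∀ t ∈ S, t < s →
        s - t ∈ ({n : ℕ | ∃ m : ℕ, 0 < m ∧ n = k * m} ∪ {p₁, p₂}) := by
  constructor
  · intro h
    have dvd_of_mem : ∀ q ∈ {n : ℕ | ∃ m : ℕ, 0 < m ∧ n = k * m} ∪ {p₁, p₂}, p₂ < q → k ∣ q := by
      rintro q (⟨m, -, rfl⟩ | rfl | rfl) hq
      · exact dvd_mul_right k m
      · omega
      · omega
    have dvd_period : ∀ p ∈ {n : ℕ | ∃ m : ℕ, 0 < m ∧ n = k * m} ∪ {p₁, p₂}, k ∣ p := by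
      intro p hp
      obtain ⟨q, hq, hqP, hqpP⟩ := h.exists_gt_add_mem hp p₂
      exact (Nat.dvd_add_right (dvd_of_mem q hqP hq)).1 (dvd_of_mem (q + p) hqpP (by omega))
    exact hnd (Nat.dvd_sub (dvd_period p₂ (by simp)) (dvd_period p₁ (by simp)))
  · refine ⟨{n | k ∣ n}, ⟨fun _ => k, fun _ => Nat.zero_lt_of_lt hk, ?_⟩, ?_⟩
    · rintro n ⟨F, -, rfl⟩
      exact Finset.dvd_sum fun _ _ => dvd_rfl
    · intro s hs t ht hts
      obtain ⟨m, hm⟩ : k ∣ s - t := Nat.dvd_sub hs ht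
      refine Or.inl ⟨m, Nat.pos_of_ne_zero ?_, hm⟩
      rintro rfl
      omega
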